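/- Under total relations, concurrency is eliminated and the completion time exceeds the total work: let t : Fin L → ℝ be start times and d : Fin L → ℝ durations with d(i) > 0 for all i, where L ≥ 1. If for all i < j both t(i) ≤ t(j) and (t(i)+d(i) < t(j) or t(j)+d(j) < t(i)) hold, then the makespan satisfies t(L-1) + d(L-1) − t(0) > ∑_{i=0}^{L-1} d(i) whenever L ≥ 2, i.e., the schedule takes strictly longer than the sum of all subtask durations. -/

import Mathlib

theorem makespan_aux (n : ℕ) : ∀ (t d : Fin (n + 2) → ℝ),
    (∀ i j : Fin (n + 2), i < j → t i + d i < t j) →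
    (∑ i, d i) < t (Fin.last (n + 1)) + d (Fin.last (n + 1)) - t 0 := by
  induction n with
  | zero =>
    intro t d h
    have h1 := h 0 1 (by decide)
    have e : Fin.last (0 + 1) = (1 : Fin 2) := rfl
    rw [Fin.sum_univ_two, e]
    linarith
  | succ n ih =>
    intro t d h
    have h1 := ih (fun i => t i.castSucc) (fun i => d i.castSucc)
      (fun i j hij => h _ _ (Fin.castSucc_lt_castSucc_iff.2 hij))
    have h2 := h (Fin.last (n + 1)).castSucc (Fin.last (n + 1 + 1)) (Fin.castSucc_lt_last _)
    rw [Fin.sum_univ_castSucc]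
    simp only [Fin.castSucc_zero] at h1
    linarith

/-- Under total relations, concurrency is eliminated and the makespan strictly
exceeds the total work whenever `L ≥ 2`. -/
theorem total_relations_makespan_exceeds_work
    (L : ℕ) (hL : 2 ≤ L) (t d : Fin L → ℝ) (hd : ∀ i, 0 < d i)
    (h : ∀ i j : Fin L, i < j →
      t i ≤ t j ∧ (t i + d i < t j ∨ t j + d j < t i)) :
    (∑ i, d i) <
      t ⟨L - 1, by omega⟩ + d ⟨L - 1, by omega⟩ - t ⟨0, by omega⟩ := by
  obtain ⟨n, rfl⟩ : ∃ n, L = n + 2 := ⟨L - 2, by omega⟩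
  refine makespan_aux n t d (fun i j hij => ?_)
  obtain ⟨h1, h2 | h2⟩ := h i j hij
  · exact h2
  · have := hd j
    linarith
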